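/- Let Ψ = (P; ≺, ∧, <lex) be the countable two-branching homogeneous pseudotree and let k ≥ 2. Then antichains of size k in Ψ have infinite big Ramsey degree: for every positive integer n there is a finite coloring of the antichains of size k in Ψ such that for every copy Ψ′ of Ψ, the antichains of size k contained in Ψ′ receive more than n colors. -/

import Mathlib

/-! ### The countable two-branching homogeneous pseudotree -/

/-- The relational data of a pseudotree on a type `P`: the tree order `≺`,
the meet operation `∧`, and the lexicographic order `<lex`. -/
structure PseudotreeData (P : Type) where
  prec : P → P → Prop
  meet : P → P → P
  lex : P → P → Prop

namespace PseudotreeData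

variable {P : Type} (Ψ : PseudotreeData P)

/-- `p ⪯ q` iff `p ≺ q` or `p = q`. -/
def preceq (p q : P) : Prop := Ψ.prec p q ∨ p = q

/-- `p` and `q` are `≺`-incomparable. -/
def Incomp (p q : P) : Prop := ¬ Ψ.preceq p q ∧ ¬ Ψ.preceq q p

/-- `Ψ` is the countable two-branching homogeneous pseudotree. -/
structure IsPseudotree : Prop where
  countable : Countable P
  infinite : Infinite P
  prec_irrefl : ∀ p, ¬ Ψ.prec p p
  prec_trans : ∀ p q r, Ψ.prec p q → Ψ.prec q r → Ψ.prec p r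
  /-- the set of predecessors of any node is linearly ordered by `≺` -/
  below_linear : ∀ p q r, Ψ.prec q p → Ψ.prec r p → Ψ.prec q r ∨ Ψ.prec r q ∨ q = r
  /-- there is a root -/
  exists_root : ∃ p₀, ∀ p, Ψ.preceq p₀ p
  /-- for the root `p₀` and `p₀ ≺ p`, the open interval `(p₀, p)` is a nonempty
  dense linear order without endpoints -/
  interval_nonempty : ∀ p₀ p, (∀ q, Ψ.preceq p₀ q) → Ψ.prec p₀ p →
    ∃ q, Ψ.prec p₀ q ∧ Ψ.prec q p
  interval_dense : ∀ p₀ p, (∀ q, Ψ.preceq p₀ q) → Ψ.prec p₀ p →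
    ∀ q r, Ψ.prec p₀ q → Ψ.prec q p → Ψ.prec p₀ r → Ψ.prec r p → Ψ.prec q r →
      ∃ s, Ψ.prec q s ∧ Ψ.prec s r
  interval_no_min : ∀ p₀ p, (∀ q, Ψ.preceq p₀ q) → Ψ.prec p₀ p →
    ∀ q, Ψ.prec p₀ q → Ψ.prec q p → ∃ s, Ψ.prec p₀ s ∧ Ψ.prec s p ∧ Ψ.prec s q
  interval_no_max : ∀ p₀ p, (∀ q, Ψ.preceq p₀ q) → Ψ.prec p₀ p →
    ∀ q, Ψ.prec p₀ q → Ψ.prec q p → ∃ s, Ψ.prec p₀ s ∧ Ψ.prec s p ∧ Ψ.prec q s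
  /-- `meet p q` is the greatest common `⪯`-lower bound of `p` and `q` -/
  meet_le_left : ∀ p q, Ψ.preceq (Ψ.meet p q) p
  meet_le_right : ∀ p q, Ψ.preceq (Ψ.meet p q) q
  le_meet : ∀ p q s, Ψ.preceq s p → Ψ.preceq s q → Ψ.preceq s (Ψ.meet p q)
  /-- `<lex` is an order on pairs of `≺`-incomparable nodes -/
  lex_incomp : ∀ p q, Ψ.lex p q → Ψ.Incomp p q
  lex_total : ∀ p q, Ψ.Incomp p q → Ψ.lex p q ∨ Ψ.lex q p
  lex_asymm : ∀ p q, Ψ.lex p q → ¬ Ψ.lex q p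
  /-- every node is two-branching -/
  two_branching : ∀ s, ∃ p q, Ψ.Incomp p q ∧ Ψ.lex p q ∧ s = Ψ.meet p q ∧
    ∀ r, Ψ.lex p r → Ψ.lex r q → Ψ.meet p r = s → Ψ.meet r q = s →
      Ψ.preceq p r ∨ Ψ.preceq q r

/-- A self-embedding of the pseudotree: preserves `≺`, meets, and `<lex` on
incomparable pairs.  A copy of `Ψ` is the range of such a map. -/
def IsEmbedding (f : P → P) : Prop :=
  (∀ p q, Ψ.prec p q ↔ Ψ.prec (f p) (f q)) ∧
  (∀ p q, f (Ψ.meet p q) = Ψ.meet (f p) (f q)) ∧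
  (∀ p q, Ψ.Incomp p q → (Ψ.lex p q ↔ Ψ.lex (f p) (f q)))

/-- A finite set of nodes forming a chain (pairwise `⪯`-comparable). -/
def IsChainSet (C : Finset P) : Prop :=
  ∀ a ∈ C, ∀ b ∈ C, Ψ.preceq a b ∨ Ψ.preceq b a

/-- A finite set of nodes forming an antichain (pairwise `≺`-incomparable). -/
def IsAntichainSet (C : Finset P) : Prop :=
  ∀ a ∈ C, ∀ b ∈ C, a ≠ b → Ψ.Incomp a b

end PseudotreeData

namespace PseudotreeRamsey

/-- A partial order in which the elements below any node are pairwise comparable and in which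
every node has at least two cones above it. -/
class BranchingForest (P : Type*) [PartialOrder P] : Prop where
  le_total_below : ∀ {p q r : P}, q ≤ p → r ≤ p → q ≤ r ∨ r ≤ q
  exists_branch : ∀ s : P, ∃ p q, s < p ∧ s < q ∧ ¬ ∃ w, s < w ∧ w ≤ p ∧ w ≤ q

/-- `x` and `y` lie in the same cone strictly above `u`. -/
def SameCone {P : Type*} [PartialOrder P] (u x y : P) : Prop :=
  ∃ w, u < w ∧ w ≤ x ∧ w ≤ y

/-- With respect to the enumeration `idx`, the path to `x` leaves at `u` the cone containing the
element of least index above `u`, and `n` is the least index in the cone of `x` above `u`. -/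
def IsTurn {P : Type*} [PartialOrder P] (idx : P → ℕ) (u x : P) (n : ℕ) : Prop :=
  (∃ y, idx y = n ∧ SameCone u x y) ∧ (∀ y, SameCone u x y → n ≤ idx y) ∧
    ∃ z, u < z ∧ ¬ SameCone u x z ∧ idx z < n

/-- The indices of the turns of `p` at nodes above the splitting point of `p` and `q`. -/
def turnsAfterSplit {P : Type*} [PartialOrder P] (idx : P → ℕ) (p q : P) : Set ℕ :=
  {n | ∃ u, IsTurn idx u p n ∧ ¬ SameCone u p q}

/-- The indices of the turns of `p'` at nodes above `p`. -/
def turnsBetween {P : Type*} [PartialOrder P] (idx : P → ℕ) (p p' : P) : Set ℕ :=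
  {n | ∃ u, p ≤ u ∧ IsTurn idx u p' n}

/-- The elements of `A` followed in `A ∪ B` by an element of `B`. -/
def switches (A B : Set ℕ) : Set ℕ :=
  {i | i ∈ A ∧ ∃ j ∈ B, i < j ∧ ∀ l ∈ A, i < l → j < l}

lemma switches_union {A B E F : Set ℕ} {m : ℕ} (hm : IsGreatest E m)
    (hEA : ∀ e ∈ E, ∀ i ∈ A ∪ B, i < e) (hF : F.Nonempty)
    (hFE : ∀ j ∈ F, ∀ i ∈ A ∪ E, i < j) :
    switches (A ∪ E) (B ∪ F) = insert m (switches A B) := by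
  obtain ⟨hmE, hmax⟩ := hm
  obtain ⟨j₀, hj₀⟩ := hF
  ext i
  rw [Set.mem_insert_iff]
  constructor
  · rintro ⟨hi, j, hj, hij, hl⟩
    by_cases him : i = m
    · exact Or.inl him
    · right
      have him' : i < m := by
        rcases hi with hi | hi
        · exact hEA m hmE i (Or.inl hi)
        · exact lt_of_le_of_ne (hmax hi) him
      have hjm := hl m (Or.inr hmE) him'
      have hjB : j ∈ B := by
        rcases hj with hj | hj
        · exact hj
        · exact absurd (hFE j hj m (Or.inr hmE)) (by omega)
      have hiA : i ∈ A := by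
        rcases hi with hi | hi
        · exact hi
        · exact absurd (hEA i hi j (Or.inr hjB)) (by omega)
      exact ⟨hiA, j, hjB, hij, fun l hlA h => hl l (Or.inl hlA) h⟩
  · rintro (rfl | ⟨hi, j, hj, hij, hl⟩)
    · refine ⟨Or.inr hmE, j₀, Or.inr hj₀, hFE j₀ hj₀ i (Or.inr hmE), ?_⟩
      rintro l (hlA | hlE) h
      · exact absurd (hEA i hmE l (Or.inl hlA)) (by omega)
      · exact absurd (hmax hlE) (by omega)
    · refine ⟨Or.inl hi, j, Or.inl hj, hij, ?_⟩
      rintro l (hlA | hlE) h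
      · exact hl l hlA h
      · exact hEA l hlE j (Or.inr hj)

lemma ncard_switches_union {A B E F : Set ℕ} (hA : A.Finite) (hEfin : E.Finite)
    (hE : E.Nonempty) (hEA : ∀ e ∈ E, ∀ i ∈ A ∪ B, i < e) (hF : F.Nonempty)
    (hFE : ∀ j ∈ F, ∀ i ∈ A ∪ E, i < j) :
    (switches (A ∪ E) (B ∪ F)).ncard = (switches A B).ncard + 1 := by
  obtain ⟨m, hm⟩ : ∃ m, IsGreatest E m := by
    obtain ⟨m, hm, h⟩ := Set.exists_max_image E id hEfin hE
    exact ⟨m, hm, fun x hx => h x hx⟩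
  rw [switches_union hm hEA hF hFE]
  refine Set.ncard_insert_of_notMem (fun h => ?_) (hA.subset fun i hi => hi.1)
  exact lt_irrefl _ (hEA m hm.1 m (Or.inl h.1))

section Forest

variable {P : Type*} [PartialOrder P] {idx : P → ℕ} {u x y z p q : P} {n : ℕ}

lemma SameCone.symm (h : SameCone u x y) : SameCone u y x := by
  obtain ⟨w, h₁, h₂, h₃⟩ := h
  exact ⟨w, h₁, h₃, h₂⟩

lemma SameCone.lt_left (h : SameCone u x y) : u < x := by
  obtain ⟨w, h₁, h₂, -⟩ := h
  exact h₁.trans_le h₂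

lemma SameCone.lt_right (h : SameCone u x y) : u < y := h.symm.lt_left

lemma IsTurn.lt (h : IsTurn idx u x n) : u < x := by
  obtain ⟨⟨y, -, hy⟩, -⟩ := h
  exact hy.lt_left

lemma IsTurn.le_idx (h : IsTurn idx u x n) : n ≤ idx x :=
  h.2.1 x ⟨x, h.lt, le_rfl, le_rfl⟩

lemma IsTurn.lt_of_lt {v : P} {m : ℕ} (hu : IsTurn idx u x n) (hv : IsTurn idx v x m)
    (huv : u < v) : n < m := by
  obtain ⟨z, hz, -, hlt⟩ := hv.2.2
  exact (hu.2.1 z ⟨v, huv, hv.lt.le, hz.le⟩).trans_lt hlt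

lemma finite_turnsAfterSplit (idx : P → ℕ) (p q : P) : (turnsAfterSplit idx p q).Finite :=
  (Set.finite_Iic (idx p)).subset fun _ ⟨_, hu, _⟩ => hu.le_idx

lemma finite_turnsBetween (idx : P → ℕ) (p q : P) : (turnsBetween idx p q).Finite :=
  (Set.finite_Iic (idx q)).subset fun _ ⟨_, _, hu⟩ => hu.le_idx

variable [BranchingForest P]

lemma SameCone.trans (h : SameCone u x y) (h' : SameCone u y z) : SameCone u x z := by
  obtain ⟨w, h₁, h₂, h₃⟩ := h
  obtain ⟨v, k₁, k₂, k₃⟩ := h'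
  rcases BranchingForest.le_total_below h₃ k₂ with hwv | hvw
  · exact ⟨w, h₁, h₂, hwv.trans k₃⟩
  · exact ⟨v, k₁, hvw.trans h₂, k₃⟩

lemma sameCone_congr (hu : u < z) (hz : z ≤ x) : SameCone u z y ↔ SameCone u x y :=
  have h : SameCone u z x := ⟨z, hu, le_rfl, hz⟩
  ⟨h.symm.trans, h.trans⟩

lemma isTurn_congr (hu : u < z) (hz : z ≤ x) : IsTurn idx u z n ↔ IsTurn idx u x n := by
  simp only [IsTurn, sameCone_congr hu hz]

lemma exists_isTurn_of_lt {y : P} (hq : u < q) (hy : SameCone u p y)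
    (hpq : ¬ SameCone u p q) (hlt : ∀ y', SameCone u q y' → idx y < idx y') :
    ∃ n, IsTurn idx u q n := by
  obtain ⟨v, hv, hmin⟩ := exists_minimalFor_of_wellFoundedLT (fun y => SameCone u q y) idx
    ⟨q, q, hq, le_rfl, le_rfl⟩
  refine ⟨idx v, ⟨v, rfl, hv⟩, fun y' hy' => ?_, y, hy.lt_right,
    fun h => hpq (hy.trans h.symm), hlt v hv⟩
  rcases le_total (idx v) (idx y') with h | h
  · exact h
  · exact hmin hy' h

lemma exists_isTurn_or (hidx : Function.Injective idx) (hp : u < p) (hq : u < q)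
    (hpq : ¬ SameCone u p q) : (∃ n, IsTurn idx u p n) ∨ ∃ n, IsTurn idx u q n := by
  by_contra! hcon
  obtain ⟨hnp, hnq⟩ := hcon
  have key : ∀ {p q : P}, u < q → ¬ SameCone u p q → (∀ n, ¬ IsTurn idx u q n) →
      ∀ y, SameCone u p y → ∃ y', SameCone u q y' ∧ idx y' < idx y := by
    intro p q hq hpq hn y hy
    by_contra! h
    obtain ⟨n, hn'⟩ := exists_isTurn_of_lt (idx := idx) hq hy hpq fun y' hy' =>
      lt_of_le_of_ne (h y' hy') fun he => hpq (hy.trans (hidx he ▸ hy'.symm))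
    exact hn n hn'
  obtain ⟨v, hv, hmin⟩ := exists_minimalFor_of_wellFoundedLT (fun y => SameCone u p y) idx
    ⟨p, p, hp, le_rfl, le_rfl⟩
  obtain ⟨v', hv', hlt⟩ := key hq hpq hnq v hv
  obtain ⟨v'', hv'', hlt'⟩ := key hp (fun h => hpq h.symm) hnp v' hv'
  have := hmin hv'' (by omega)
  omega

lemma finite_turningPoints (idx : P → ℕ) (x : P) : {u | ∃ n, IsTurn idx u x n}.Finite := by
  classical
  choose! g hg using fun (u : P) (h : ∃ n, IsTurn idx u x n) => h
  refine Set.Finite.of_finite_image (f := g) ((Set.finite_Iic (idx x)).subset ?_) ?_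
  · rintro _ ⟨u, hu, rfl⟩
    exact (hg u hu).le_idx
  · intro u hu v hv huv
    have hu' := hg u hu
    have hv' := hg v hv
    by_contra hne
    rcases BranchingForest.le_total_below hu'.lt.le hv'.lt.le with h | h
    · exact (hu'.lt_of_lt hv' (lt_of_le_of_ne h hne)).ne huv
    · exact (hv'.lt_of_lt hu' (lt_of_le_of_ne h (Ne.symm hne))).ne huv.symm

lemma turnsAfterSplit_extend_left {p' : P} (hp : p ≤ p') (hpq : ¬ p ≤ q) :
    turnsAfterSplit idx p' q = turnsAfterSplit idx p q ∪ turnsBetween idx p p' := by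
  ext n
  constructor
  · rintro ⟨u, hu, hs⟩
    by_cases hpu : p ≤ u
    · exact Or.inr ⟨u, hpu, hu⟩
    · have hup : u < p := lt_of_le_not_ge
        ((BranchingForest.le_total_below hp hu.lt.le).resolve_left hpu) hpu
      exact Or.inl ⟨u, (isTurn_congr hup hp).2 hu, fun h => hs ((sameCone_congr hup hp).1 h)⟩
  · rintro (⟨u, hu, hs⟩ | ⟨u, hpu, hu⟩)
    · exact ⟨u, (isTurn_congr hu.lt hp).1 hu, fun h => hs ((sameCone_congr hu.lt hp).2 h)⟩
    · refine ⟨u, hu, ?_⟩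
      rintro ⟨w, hw, -, hwq⟩
      exact hpq (hpu.trans (hw.le.trans hwq))

lemma turnsAfterSplit_extend_right {p' : P} (hp : p ≤ p') (hpq : ¬ p ≤ q) :
    turnsAfterSplit idx q p' = turnsAfterSplit idx q p := by
  have h : ∀ u, SameCone u q p' ↔ SameCone u q p := by
    refine fun u => ⟨?_, ?_⟩
    · rintro ⟨w, hw, hwq, hwp⟩
      rcases BranchingForest.le_total_below hp hwp with h | h
      · exact absurd (h.trans hwq) hpq
      · exact ⟨w, hw, hwq, h⟩
    · rintro ⟨w, hw, hwq, hwp⟩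
      exact ⟨w, hw, hwq, hwp.trans hp⟩
  simp only [turnsAfterSplit, h]

end Forest

/-- Finitely many hereditary properties of intervals, each holding densely, hold simultaneously
densely. -/
lemma exists_interval_forall_finite {P ι : Type*} [PartialOrder P] {R : ι → P → P → Prop}
    (hmono : ∀ i a a' c c', R i a a' → a ≤ c → c' ≤ a' → R i c c') {a₀ a₁ : P}
    (hdense : ∀ i a a', a < a' → a' ≤ a₁ → ∃ c c', a ≤ c ∧ c < c' ∧ c' ≤ a' ∧ R i c c')
    {S : Set ι} (hS : S.Finite) (h : a₀ < a₁) :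
    ∃ c c', a₀ ≤ c ∧ c < c' ∧ c' ≤ a₁ ∧ ∀ i ∈ S, R i c c' := by
  induction S, hS using Set.Finite.induction_on with
  | empty => exact ⟨a₀, a₁, le_rfl, h, le_rfl, by simp⟩
  | @insert i S _ _ ih =>
    obtain ⟨c, c', h₁, h₂, h₃, h₄⟩ := ih
    obtain ⟨d, d', k₁, k₂, k₃, k₄⟩ := hdense i c c' h₂ h₃
    refine ⟨d, d', h₁.trans k₁, k₂, k₃.trans h₃, ?_⟩
    rintro j (rfl | hj)
    · exact k₄
    · exact hmono j _ _ _ _ (h₄ j hj) k₁ k₃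

section Embedding

variable {P : Type*} [PartialOrder P] {idx : P → ℕ}

/-- The path from `f a` to `f a'` has no turns. -/
def TurnFree (idx : P → ℕ) (f : P → P) (a a' : P) : Prop :=
  a < a' ∧ ∀ u n, f a ≤ u → u < f a' → ¬ IsTurn idx u (f a') n

lemma TurnFree.turnsBetween_eq_empty [BranchingForest P] {f : P ↪o P} {a a' x : P} (h : TurnFree idx f a a')
    (hx : x ≤ a') : turnsBetween idx (f a) (f x) = ∅ := by
  refine Set.eq_empty_of_forall_notMem ?_
  rintro n ⟨u, hu, hn⟩
  exact h.2 u n hu (hn.lt.trans_le (f.monotone hx)) ((isTurn_congr hn.lt (f.monotone hx)).1 hn)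

lemma TurnFree.exists_idx_gt [DenselyOrdered P] {f : P ↪o P} (hidx : Function.Injective idx) {a a' : P}
    (h : TurnFree idx f a a') (N : ℕ) : ∃ x, a < x ∧ x < a' ∧ N < idx (f x) := by
  by_contra! hcon
  refine Set.Ioo_infinite h.1 (((Set.finite_Iic N).preimage
    (hidx.comp f.injective).injOn).subset fun x hx => ?_)
  exact hcon x hx.1 hx.2

variable [DenselyOrdered P] [BranchingForest P]

lemma exists_turnFree (f : P ↪o P) (idx : P → ℕ) {a₀ a₁ : P} (h : a₀ < a₁) :
    ∃ a a', a₀ < a ∧ a' ≤ a₁ ∧ TurnFree idx f a a' := by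
  obtain ⟨b, hb₀, hb₁⟩ := exists_between h
  obtain ⟨a, a', h₁, h₂, h₃, h₄⟩ := exists_interval_forall_finite
    (R := fun u a a' => ¬ (f a ≤ u ∧ u < f a'))
    (fun u a a' c c' hR h₁ h₂ ⟨k₁, k₂⟩ =>
      hR ⟨(f.monotone h₁).trans k₁, k₂.trans_le (f.monotone h₂)⟩)
    (a₁ := a₁) (fun u a a' h _ => by
      obtain ⟨z, hz, hz'⟩ := exists_between h
      by_cases hu : f z ≤ u
      · exact ⟨a, z, le_rfl, hz, hz'.le, fun ⟨_, k⟩ => k.not_ge hu⟩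
      · exact ⟨z, a', hz.le, hz', le_rfl, fun ⟨k, _⟩ => hu k⟩)
    (finite_turningPoints idx (f a₁)) hb₁
  exact ⟨a, a', hb₀.trans_le h₁, h₃, h₂, fun u n hu hu' hn =>
    h₄ u ⟨n, (isTurn_congr hu' (f.monotone h₃)).1 hn⟩ ⟨hu, hu'⟩⟩

lemma TurnFree.exists_extension {f : P ↪o P} (hidx : Function.Injective idx)
    (hf : ∀ u x y, u < x → u < y → ¬ SameCone u x y → ¬ SameCone (f u) (f x) (f y))
    {a a' : P} (h : TurnFree idx f a a') (N : ℕ) :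
    ∃ b b', a < b ∧ TurnFree idx f b b' ∧ (turnsBetween idx (f a) (f b)).Nonempty ∧
      ∀ n ∈ turnsBetween idx (f a) (f b), N < n := by
  obtain ⟨c, c', h₁, h₂, h₃, h₄⟩ := exists_interval_forall_finite
    (R := fun y c c' => ∀ t, c < t → t < c' → f t < y → SameCone (f t) y (f a'))
    (fun y a a' c c' hR h₁ h₂ t ht ht' => hR t (h₁.trans_lt ht) (ht'.trans_le h₂))
    (a₁ := a') (fun y d d' hd hd' => by
      by_cases hex : ∃ t, d < t ∧ t < d' ∧ f t < y
      · obtain ⟨t, ht, ht', hty⟩ := hex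
        by_cases hex' : ∃ t', d < t' ∧ t' < d' ∧ f t' < y ∧ ¬ SameCone (f t') y (f a')
        · obtain ⟨t', k₁, k₂, k₃, k₄⟩ := hex'
          refine ⟨t', d', k₁.le, k₂, le_rfl, fun v hv hv' hvy => ?_⟩
          exact absurd ⟨f v, f.strictMono hv, hvy.le, f.monotone (hv'.le.trans hd')⟩ k₄
        · refine ⟨d, d', le_rfl, hd, le_rfl, fun v hv hv' hvy => ?_⟩
          by_contra hcon
          exact hex' ⟨v, hv, hv', hvy, hcon⟩
      · exact ⟨d, d', le_rfl, hd, le_rfl, fun t ht ht' hty => absurd ⟨t, ht, ht', hty⟩ hex⟩)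
    ((Set.finite_Iic N).preimage hidx.injOn) h.1
  obtain ⟨t, hct, htc⟩ := exists_between h₂
  have hta' : t < a' := htc.trans_le h₃
  have hat : a < t := h₁.trans_lt hct
  obtain ⟨x, htx, hxa⟩ : ∃ x, t < x ∧ ¬ SameCone t x a' := by
    obtain ⟨p, q, hp, hq, hpq⟩ := BranchingForest.exists_branch t
    by_cases hpa : SameCone t p a'
    · exact ⟨q, hq, fun hqa => hpq (hpa.trans hqa.symm)⟩
    · exact ⟨p, hp, hpa⟩
  have hxa' := hf t x a' htx hta' hxa
  have hlarge : ∀ y, SameCone (f t) (f x) y → N < idx y := by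
    intro y hy
    by_contra hN
    exact hxa' (hy.trans (h₄ y (not_lt.1 hN) t hct htc hy.lt_right))
  obtain ⟨m, hm⟩ : ∃ m, IsTurn idx (f t) (f x) m := by
    rcases exists_isTurn_or hidx (f.strictMono htx) (f.strictMono hta') hxa' with hx | ⟨m, hm⟩
    · exact hx
    · exact absurd hm (h.2 _ _ (f.monotone hat.le) (f.strictMono hta'))
  obtain ⟨b, b', htb, hbx, hfree⟩ := exists_turnFree f idx htx
  have hbx' : f b ≤ f x := f.monotone (hfree.1.le.trans hbx)
  refine ⟨b, b', hat.trans htb, hfree,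
    ⟨m, f t, f.monotone hat.le, (isTurn_congr (f.strictMono htb) hbx').2 hm⟩, ?_⟩
  rintro n ⟨u, hau, hu⟩
  by_cases htu : f t ≤ u
  · obtain ⟨⟨y, rfl, w, hw, hwb, hwy⟩, -⟩ := hu
    exact hlarge y ⟨w, htu.trans_lt hw, hwb.trans hbx', hwy⟩
  · have hut : u < f t := lt_of_le_not_ge
      ((BranchingForest.le_total_below (f.monotone htb.le) hu.lt.le).resolve_left htu) htu
    have hut' := (isTurn_congr hut (f.monotone htb.le)).2 hu
    exact absurd ((isTurn_congr hut (f.monotone hta'.le)).1 hut')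
      (h.2 _ _ hau (hut.trans (f.strictMono hta')))

/-- The number of times the turns of `q` take over from those of `p` after `p` and `q` split. -/
noncomputable def switchCount (idx : P → ℕ) (p q : P) : ℕ :=
  (switches (turnsAfterSplit idx p q) (turnsAfterSplit idx q p)).ncard

lemma exists_turnFree_pair {f : P ↪o P} (hidx : Function.Injective idx)
    (hf : ∀ u x y, u < x → u < y → ¬ SameCone u x y → ¬ SameCone (f u) (f x) (f y)) (t : P) :
    ∃ m₀, ∀ m, ∃ a a' b b', t < a ∧ t < b ∧ ¬ a ≤ b ∧ ¬ b ≤ a ∧ TurnFree idx f a a' ∧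
      TurnFree idx f b b' ∧ switchCount idx (f a) (f b) = m₀ + m := by
  obtain ⟨p, q, hp, hq, hpq⟩ := BranchingForest.exists_branch t
  obtain ⟨a, a', hta, hap, hafree⟩ := exists_turnFree f idx hp
  obtain ⟨b, b', htb, hbq, hbfree⟩ := exists_turnFree f idx hq
  have hap' := hafree.1.le.trans hap
  have hbq' := hbfree.1.le.trans hbq
  refine ⟨switchCount idx (f a) (f b), fun m => ?_⟩
  induction m with
  | zero =>
    exact ⟨a, a', b, b', hta, htb, fun h => hpq ⟨a, hta, hap', h.trans hbq'⟩,
      fun h => hpq ⟨b, htb, h.trans hap', hbq'⟩, hafree, hbfree, rfl⟩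
  | succ m ih =>
    obtain ⟨c, c', d, d', htc, htd, hcd, hdc, hc, hd, hcount⟩ := ih
    obtain ⟨N, hN⟩ := ((finite_turnsAfterSplit idx (f c) (f d)).union
      (finite_turnsAfterSplit idx (f d) (f c))).bddAbove
    obtain ⟨e, e', hce, he, hne, hlarge⟩ := hc.exists_extension hidx hf N
    obtain ⟨M, hM⟩ := ((finite_turnsAfterSplit idx (f c) (f d)).union
      (finite_turnsBetween idx (f c) (f e))).bddAbove
    obtain ⟨g, g', hdg, hg, hne', hlarge'⟩ := hd.exists_extension hidx hf M
    have hed : ¬ e ≤ d := fun h => hcd (hce.le.trans h)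
    have hde : ¬ d ≤ e := fun h =>
      (BranchingForest.le_total_below hce.le h).elim hcd hdc
    have hge : ¬ g ≤ e := fun h => hde (hdg.le.trans h)
    have heg : ¬ e ≤ g := fun h =>
      (BranchingForest.le_total_below hdg.le h).elim hde hed
    refine ⟨e, e', g, g', htc.trans hce, htd.trans hdg, heg, hge, he, hg, ?_⟩
    have hfc : f c ≤ f e := f.monotone hce.le
    have hfd : f d ≤ f g := f.monotone hdg.le
    have hfcd : ¬ f c ≤ f d := fun h => hcd (f.le_iff_le.1 h)
    have hfde : ¬ f d ≤ f e := fun h => hde (f.le_iff_le.1 h)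
    rw [switchCount, turnsAfterSplit_extend_right hfd hfde,
      turnsAfterSplit_extend_left hfd hfde, turnsAfterSplit_extend_left hfc hfcd,
      turnsAfterSplit_extend_right hfc hfcd,
      ncard_switches_union (finite_turnsAfterSplit _ _ _) (finite_turnsBetween _ _ _) hne
        (fun k hk i hi => (hN hi).trans_lt (hlarge k hk)) hne'
        (fun k hk i hi => (hM hi).trans_lt (hlarge' k hk)), ← add_assoc, ← hcount]
    rfl

end Embedding

lemma exists_antichain_incomparable {P : Type*} [PartialOrder P] [BranchingForest P] (t₀ : P)
    (m : ℕ) : ∃ (C : Finset P) (t : P), C.card = m ∧ IsAntichain (· ≤ ·) (C : Set P) ∧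
      ∀ c ∈ C, ¬ c ≤ t ∧ ¬ t ≤ c := by
  classical
  induction m with
  | zero => exact ⟨∅, t₀, by simp⟩
  | succ m ih =>
    obtain ⟨C, t, hcard, hC, ht⟩ := ih
    obtain ⟨p, q, hp, hq, hpq⟩ := BranchingForest.exists_branch t
    have habove : ∀ x, t < x → ∀ c ∈ C, ¬ c ≤ x ∧ ¬ x ≤ c := fun x hx c hc =>
      ⟨fun h => (BranchingForest.le_total_below h hx.le).elim (ht c hc).1 (ht c hc).2,
        fun h => (ht c hc).2 (hx.le.trans h)⟩
    have hpC : p ∉ C := fun h => (habove p hp p h).1 le_rfl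
    refine ⟨insert p C, q, by rw [Finset.card_insert_of_notMem hpC, hcard], ?_, ?_⟩
    · rw [Finset.coe_insert]
      exact hC.insert (fun c hc _ => (habove p hp c hc).1) (fun c hc _ => (habove p hp c hc).2)
    · intro c hc
      rcases Finset.mem_insert.1 hc with rfl | hc
      · exact ⟨fun h => hpq ⟨c, hp, le_rfl, h⟩, fun h => hpq ⟨q, hq, h, le_rfl⟩⟩
      · exact habove q hq c hc

/-- `a` and `b` are, in this order, the two elements of largest index in `A`. -/
def LastTwo {P : Type*} (idx : P → ℕ) (A : Finset P) (a b : P) : Prop :=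
  a ∈ A ∧ b ∈ A ∧ idx a < idx b ∧ ∀ c ∈ A, c = b ∨ idx c ≤ idx a

lemma LastTwo.unique {P : Type*} {idx : P → ℕ} (hidx : Function.Injective idx) {A : Finset P}
    {a b a' b' : P} (h : LastTwo idx A a b) (h' : LastTwo idx A a' b') : a = a' ∧ b = b' := by
  obtain ⟨ha, hb, hab, hmax⟩ := h
  obtain ⟨ha', hb', hab', hmax'⟩ := h'
  have hbb : b = b' := by
    rcases hmax b' hb' with h | h
    · exact h.symm
    · rcases hmax' b hb with h' | h'
      · exact h'
      · omega
  subst hbb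
  refine ⟨hidx (le_antisymm ?_ ?_), rfl⟩
  · rcases hmax' a ha with h | h
    · exact absurd hab (by rw [h]; exact lt_irrefl _)
    · exact h
  · rcases hmax a' ha' with h | h
    · exact absurd hab' (by rw [h]; exact lt_irrefl _)
    · exact h

theorem exists_coloring_surjective_on_copies {P : Type*} [PartialOrder P] [Countable P]
    [Nonempty P] [DenselyOrdered P] [BranchingForest P] (k : ℕ) (hk : 2 ≤ k) (n : ℕ) :
    ∃ χ : Finset P → Fin (n + 1), ∀ f : P ↪o P,
      (∀ u x y, u < x → u < y → ¬ SameCone u x y → ¬ SameCone (f u) (f x) (f y)) →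
      ∀ i, ∃ A : Finset P, A.card = k ∧ IsAntichain (· ≤ ·) (A : Set P) ∧
        (A : Set P) ⊆ Set.range f ∧ χ A = i := by
  classical
  obtain ⟨idx, hidx⟩ := exists_injective_nat P
  have hcol : ∀ A : Finset P, ∃ v : Fin (n + 1), ∀ a b, LastTwo idx A a b →
      v = Fin.ofNat (n + 1) (switchCount idx a b) := by
    intro A
    by_cases h : ∃ a b, LastTwo idx A a b
    · obtain ⟨a, b, h⟩ := h
      refine ⟨Fin.ofNat (n + 1) (switchCount idx a b), fun a' b' h' => ?_⟩
      obtain ⟨rfl, rfl⟩ := h.unique hidx h'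
      rfl
    · exact ⟨0, fun a b hab => absurd ⟨a, b, hab⟩ h⟩
  choose χ hχ using hcol
  refine ⟨χ, fun f hf i => ?_⟩
  obtain ⟨C, t, hcard, hC, ht⟩ := exists_antichain_incomparable (Classical.arbitrary P) (k - 2)
  obtain ⟨m₀, hm⟩ := exists_turnFree_pair hidx hf t
  obtain ⟨a, a', b, b', hta, htb, hab, hba, ha, hb, hcount⟩ := hm (i + m₀ * n)
  obtain ⟨N, hN⟩ := (C.image fun c => idx (f c)).bddAbove
  obtain ⟨x, hax, hxa, hNx⟩ := ha.exists_idx_gt hidx N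
  obtain ⟨y, hby, hyb, hxy⟩ := hb.exists_idx_gt hidx (idx (f x))
  have hxb : ¬ x ≤ b := fun h => hab (hax.le.trans h)
  have hbx : ¬ b ≤ x := fun h => (BranchingForest.le_total_below hax.le h).elim hab hba
  have hyx : ¬ y ≤ x := fun h => hbx (hby.le.trans h)
  have hxy' : ¬ x ≤ y := fun h => (BranchingForest.le_total_below hby.le h).elim hbx hxb
  have habove : ∀ z, t < z → ∀ c ∈ C, ¬ c ≤ z ∧ ¬ z ≤ c := fun z hz c hc =>
    ⟨fun h => (BranchingForest.le_total_below h hz.le).elim (ht c hc).1 (ht c hc).2,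
      fun h => (ht c hc).2 (hz.le.trans h)⟩
  have hxC := habove x (hta.trans hax)
  have hyC := habove y (htb.trans hby)
  have hCx : x ∉ C := fun h => (hxC x h).1 le_rfl
  have hCy : y ∉ insert x C := by
    rw [Finset.mem_insert]
    rintro (h | h)
    · exact hyx h.le
    · exact (hyC y h).1 le_rfl
  refine ⟨(insert y (insert x C)).map f.toEmbedding, ?_, ?_, ?_, ?_⟩
  · rw [Finset.card_map, Finset.card_insert_of_notMem hCy, Finset.card_insert_of_notMem hCx,
      hcard]
    omega
  · have hanti : IsAntichain (· ≤ ·) ((insert y (insert x C) : Finset P) : Set P) := by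
      rw [Finset.coe_insert, Finset.coe_insert]
      refine (hC.insert (fun c hc _ => (hxC c hc).1) (fun c hc _ => (hxC c hc).2)).insert ?_ ?_
      · rintro c (rfl | hc) -
        · exact hxy'
        · exact (hyC c hc).1
      · rintro c (rfl | hc) -
        · exact hyx
        · exact (hyC c hc).2
    rw [Finset.coe_map]
    rintro _ ⟨p, hp, rfl⟩ _ ⟨q, hq, rfl⟩ hne hle
    exact hanti hp hq (fun h => hne (by rw [h])) (f.le_iff_le.1 hle)
  · rw [Finset.coe_map]
    exact Set.image_subset_range _ _
  · have hlast : LastTwo idx ((insert y (insert x C)).map f.toEmbedding) (f x) (f y) := by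
      refine ⟨Finset.mem_map_of_mem f.toEmbedding (by simp),
        Finset.mem_map_of_mem f.toEmbedding (by simp), hxy, ?_⟩
      intro d hd
      obtain ⟨c, hc, rfl⟩ := Finset.mem_map.1 hd
      rcases Finset.mem_insert.1 hc with rfl | hc
      · exact Or.inl rfl
      rcases Finset.mem_insert.1 hc with rfl | hc
      · exact Or.inr le_rfl
      · exact Or.inr ((hN (Finset.mem_coe.2 (Finset.mem_image_of_mem _ hc))).trans hNx.le)
    have hfax : f a ≤ f x := f.monotone hax.le
    have hfby : f b ≤ f y := f.monotone hby.le
    have hfab : ¬ f a ≤ f b := fun h => hab (f.le_iff_le.1 h)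
    have hfbx : ¬ f b ≤ f x := fun h => hbx (f.le_iff_le.1 h)
    have heq : switchCount idx (f x) (f y) = switchCount idx (f a) (f b) := by
      rw [switchCount, turnsAfterSplit_extend_right hfby hfbx,
        turnsAfterSplit_extend_left hfby hfbx, turnsAfterSplit_extend_left hfax hfab,
        turnsAfterSplit_extend_right hfax hfab, ha.turnsBetween_eq_empty hxa.le,
        hb.turnsBetween_eq_empty hyb.le, Set.union_empty, Set.union_empty, switchCount]
    rw [hχ _ _ _ hlast, heq, hcount]
    ext
    have hval : m₀ + ((i : ℕ) + m₀ * n) = i + (n + 1) * m₀ := by ring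
    rw [hval, Fin.val_ofNat, Nat.add_mul_mod_self_left, Nat.mod_eq_of_lt i.isLt]

end PseudotreeRamsey

namespace PseudotreeData.IsPseudotree

open PseudotreeRamsey

variable {P : Type} {Ψ : PseudotreeData P}

/-- The tree order of a pseudotree as a partial order. -/
abbrev toPartialOrder (hΨ : Ψ.IsPseudotree) : PartialOrder P where
  le := Ψ.preceq
  lt := Ψ.prec
  le_refl p := Or.inr rfl
  le_trans := by
    rintro p q r (h | rfl) (h' | rfl)
    · exact Or.inl (hΨ.prec_trans _ _ _ h h')
    · exact Or.inl h
    · exact Or.inl h'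
    · exact Or.inr rfl
  le_antisymm := by
    rintro p q (h | h) (h' | h')
    · exact absurd (hΨ.prec_trans _ _ _ h h') (hΨ.prec_irrefl _)
    · exact h'.symm
    · exact h
    · exact h
  lt_iff_le_not_ge := by
    intro p q
    constructor
    · intro h
      refine ⟨Or.inl h, ?_⟩
      rintro (h' | rfl)
      · exact hΨ.prec_irrefl _ (hΨ.prec_trans _ _ _ h h')
      · exact hΨ.prec_irrefl _ h
    · rintro ⟨h | rfl, h'⟩
      · exact h
      · exact absurd (Or.inr rfl) h'

lemma exists_prec_prec (hΨ : Ψ.IsPseudotree) {p q : P} (h : Ψ.prec p q) :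
    ∃ s, Ψ.prec p s ∧ Ψ.prec s q := by
  obtain ⟨p₀, hp₀⟩ := hΨ.exists_root
  rcases hp₀ p with hp | rfl
  · obtain ⟨s, -, h₁, h₂⟩ :=
      hΨ.interval_no_max p₀ q hp₀ (hΨ.prec_trans _ _ _ hp h) p hp h
    exact ⟨s, h₂, h₁⟩
  · exact hΨ.interval_nonempty p₀ q hp₀ h

lemma branchingForest (hΨ : Ψ.IsPseudotree) :
    letI := hΨ.toPartialOrder
    BranchingForest P := by
  let _ := hΨ.toPartialOrder
  refine ⟨?_, fun s => ?_⟩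
  · rintro p q r (hq | rfl) (hr | rfl)
    · rcases hΨ.below_linear p q r hq hr with h | h | h
      · exact Or.inl (Or.inl h)
      · exact Or.inr (Or.inl h)
      · exact Or.inl (Or.inr h)
    · exact Or.inl (Or.inl hq)
    · exact Or.inr (Or.inl hr)
    · exact Or.inl (Or.inr rfl)
  · obtain ⟨p, q, ⟨hpq, hqp⟩, -, rfl, -⟩ := hΨ.two_branching s
    have hl := hΨ.meet_le_left p q
    have hr := hΨ.meet_le_right p q
    refine ⟨p, q, lt_of_le_of_ne hl fun h => hpq ?_, lt_of_le_of_ne hr fun h => hqp ?_, ?_⟩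
    · rwa [h] at hr
    · rwa [h] at hl
    · rintro ⟨w, hw, hwp, hwq⟩
      exact hw.not_ge (hΨ.le_meet p q w hwp hwq)

lemma injective_of_isEmbedding (hΨ : Ψ.IsPseudotree) {f : P → P} (hf : Ψ.IsEmbedding f) :
    Function.Injective f := by
  let _ := hΨ.toPartialOrder
  obtain ⟨hprec, hmeet, -⟩ := hf
  have self_meet : ∀ p, Ψ.meet p p = p := fun p =>
    le_antisymm (α := P) (hΨ.meet_le_left p p) (hΨ.le_meet p p p (Or.inr rfl) (Or.inr rfl))
  intro p q h
  have hm := hmeet p q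
  rw [h, self_meet] at hm
  have h₁ : Ψ.meet p q = p := (hΨ.meet_le_left p q).resolve_left fun hlt =>
    hΨ.prec_irrefl (f q) (by simpa only [hm, h] using (hprec _ _).1 hlt)
  have h₂ : Ψ.meet p q = q := (hΨ.meet_le_right p q).resolve_left fun hlt =>
    hΨ.prec_irrefl (f q) (by simpa only [hm] using (hprec _ _).1 hlt)
  exact h₁.symm.trans h₂

end PseudotreeData.IsPseudotree

/-- Antichains of size `k ≥ 2` in the countable two-branching
homogeneous pseudotree have infinite big Ramsey degree: for every positive `n`
there is a finite coloring of the size-`k` antichains such that in every copy of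
`Ψ` they receive more than `n` colors. -/
theorem pseudotree_antichains_infinite_big_ramsey_degree
    {P : Type} (Ψ : PseudotreeData P) (hΨ : Ψ.IsPseudotree)
    (k : ℕ) (hk : 2 ≤ k) :
    ∀ n : ℕ, 1 ≤ n →
      ∃ (r : ℕ) (χ : Finset P → Fin r),
        ∀ f : P → P, Ψ.IsEmbedding f →
          ∀ I : Finset (Fin r),
            (∀ A : Finset P, A.card = k → Ψ.IsAntichainSet A → ↑A ⊆ Set.range f →
              χ A ∈ I) →
            n < I.card := by
  let _ := hΨ.toPartialOrder
  have := hΨ.countable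
  have : Nonempty P := hΨ.infinite.nonempty
  have := hΨ.branchingForest
  have : DenselyOrdered P := ⟨fun _ _ h => hΨ.exists_prec_prec h⟩
  intro n _
  obtain ⟨χ, hχ⟩ := PseudotreeRamsey.exists_coloring_surjective_on_copies (P := P) k hk n
  refine ⟨n + 1, χ, fun f hf I hI => ?_⟩
  have hinj := hΨ.injective_of_isEmbedding hf
  let g : P ↪o P := ⟨⟨f, hinj⟩, fun {p q} =>
    or_congr (hf.1 p q).symm hinj.eq_iff⟩
  have hg : ∀ u x y, u < x → u < y → ¬ PseudotreeRamsey.SameCone u x y →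
      ¬ PseudotreeRamsey.SameCone (g u) (g x) (g y) := by
    rintro u x y hx hy hs ⟨w, hw, hwx, hwy⟩
    have hu : u = Ψ.meet x y :=
      (hΨ.le_meet x y u hx.le hy.le).resolve_left fun h =>
        hs ⟨Ψ.meet x y, h, hΨ.meet_le_left x y, hΨ.meet_le_right x y⟩
    have hle : w ≤ f u := by
      rw [hu, hf.2.1]
      exact hΨ.le_meet _ _ w hwx hwy
    exact hw.not_ge hle
  have hI' : I = Finset.univ := by
    refine Finset.eq_univ_of_forall fun i => ?_
    obtain ⟨A, hcard, hA, hrange, rfl⟩ := hχ g hg i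
    exact hI A hcard (fun a ha b hb hab => ⟨hA ha hb hab, hA hb ha hab.symm⟩) hrange
  rw [hI', Finset.card_univ, Fintype.card_fin]
  exact Nat.lt_succ_self n
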